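/- Fix 0 < q < 1, define f_q(z) = (1-q)(z + ∑_{k=1}^∞ q^k (1-q^{kz})/(1-q^k)) and h_q(t) = (1-q) ∑_{k > t/log(1/q)} q^k/(1-q^k) for t ≥ 0. Then for every complex z with Re z > 0, f_q(z)/z = (1-q) + ∫_0^∞ e^{−tz} h_q(t) dt. -/

import Mathlib

open MeasureTheory

/-- The Bernstein transform of the Jackson measure `d_q t`. -/
noncomputable def fq (q : ℝ) (z : ℂ) : ℂ :=
  (1 - q) * (z + ∑' k : ℕ,
    (q : ℂ) ^ (k + 1) * (1 - (q : ℂ) ^ (((k : ℂ) + 1) * z)) / (1 - (q : ℂ) ^ (k + 1)))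

/-- `h_q(t) = (1-q) ∑_{k log(1/q) > t, k ≥ 1} q^k/(1-q^k)`. -/
noncomputable def hq (q : ℝ) (t : ℝ) : ℝ :=
  (1 - q) * ∑' k : ℕ,
    if t < ((k : ℝ) + 1) * Real.log (1 / q) then q ^ (k + 1) / (1 - q ^ (k + 1)) else 0

lemma setIntegral_Ioi_exp_mul_ite {z : ℂ} (hz : z ≠ 0) {a : ℝ} (ha : 0 ≤ a) (c : ℝ) :
    ∫ t in Set.Ioi (0 : ℝ), Complex.exp (-(t : ℂ) * z) * ((if t < a then c else 0 : ℝ) : ℂ) =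
      c * (1 - Complex.exp (-(a : ℂ) * z)) / z := by
  have h : (fun t : ℝ => Complex.exp (-(t : ℂ) * z) * ((if t < a then c else 0 : ℝ) : ℂ)) =
      (Set.Iio a).indicator (fun t : ℝ => Complex.exp (-z * t) * (c : ℂ)) := by
    ext t
    by_cases ht : t < a <;> simp [ht, mul_comm]
  rw [h, setIntegral_indicator measurableSet_Iio, Set.Ioi_inter_Iio, ← integral_Ioc_eq_integral_Ioo,
    ← intervalIntegral.integral_of_le ha, intervalIntegral.integral_mul_const,
    integral_exp_mul_complex (neg_ne_zero.mpr hz), neg_mul_comm, mul_comm z]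
  simp
  field_simp
  ring

lemma integrableOn_Ioi_exp_mul_ite {z : ℂ} (hz : 0 < z.re) (a c : ℝ) :
    IntegrableOn (fun t : ℝ => Complex.exp (-(t : ℂ) * z) * ((if t < a then c else 0 : ℝ) : ℂ))
      (Set.Ioi 0) := by
  have h : (fun t : ℝ => Complex.exp (-(t : ℂ) * z) * ((if t < a then c else 0 : ℝ) : ℂ)) =
      (Set.Iio a).indicator (fun t : ℝ => Complex.exp (-z * t) * (c : ℂ)) := by
    ext t
    by_cases ht : t < a <;> simp [ht, mul_comm]
  rw [h]
  exact ((integrableOn_exp_mul_complex_Ioi (by simpa using hz) 0).mul_const _).indicator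
    measurableSet_Iio

lemma setIntegral_Ioi_norm_exp_mul_ite_le {z : ℂ} (hz : 0 < z.re) (a : ℝ) {c : ℝ} (hc : 0 ≤ c) :
    ∫ t in Set.Ioi (0 : ℝ), ‖Complex.exp (-(t : ℂ) * z) * ((if t < a then c else 0 : ℝ) : ℂ)‖ ≤
      c / z.re := by
  have hre : -z.re < 0 := neg_lt_zero.mpr hz
  calc
    _ ≤ ∫ t in Set.Ioi (0 : ℝ), Real.exp (-z.re * t) * c := by
      refine integral_mono (integrableOn_Ioi_exp_mul_ite hz a c).norm
        ((integrableOn_exp_mul_Ioi hre 0).mul_const c) fun t => ?_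
      by_cases ht : t < a
      · simp [ht, Complex.norm_exp, abs_of_nonneg hc, mul_comm]
      · simp only [ht, if_false, Complex.ofReal_zero, mul_zero, norm_zero]
        positivity
    _ = c / z.re := by
      rw [integral_mul_const, integral_exp_mul_Ioi hre]
      simp
      field_simp

/-- The Laplace transform of a summable superposition of indicators of intervals `(-∞, a k)`. -/
lemma hasSum_setIntegral_Ioi_exp_mul_tsum_ite {z : ℂ} (hz : 0 < z.re) {a c : ℕ → ℝ}
    (ha : ∀ k, 0 ≤ a k) (hc : ∀ k, 0 ≤ c k) (hs : Summable c) :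
    HasSum (fun k => (c k : ℂ) * (1 - Complex.exp (-(a k : ℂ) * z)) / z)
      (∫ t in Set.Ioi (0 : ℝ),
        Complex.exp (-(t : ℂ) * z) * ((∑' k, if t < a k then c k else 0 : ℝ) : ℂ)) := by
  have hz0 : z ≠ 0 := fun h => by simp [h] at hz
  have key := hasSum_integral_of_summable_integral_norm
    (fun k => integrableOn_Ioi_exp_mul_ite hz (a k) (c k))
    (Summable.of_nonneg_of_le (fun k => integral_nonneg fun t => norm_nonneg _)
      (fun k => setIntegral_Ioi_norm_exp_mul_ite_le hz (a k) (hc k)) (hs.div_const z.re))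
  simp only [setIntegral_Ioi_exp_mul_ite hz0 (ha _), tsum_mul_left] at key
  simpa only [Complex.ofReal_tsum] using key

lemma summable_pow_succ_div_one_sub_pow_succ {q : ℝ} (hq0 : 0 < q) (hq1 : q < 1) :
    Summable fun k : ℕ => q ^ (k + 1) / (1 - q ^ (k + 1)) := by
  have hlt (k : ℕ) : q ^ (k + 1) < 1 := pow_lt_one₀ hq0.le hq1 k.succ_ne_zero
  refine Summable.of_nonneg_of_le
    (fun k => div_nonneg (by positivity) (sub_nonneg.mpr (hlt k).le)) (fun k => ?_)
    (((summable_nat_add_iff 1).mpr (summable_geometric_of_lt_one hq0.le hq1)).div_const (1 - q))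
  have hle : q ^ (k + 1) ≤ q := pow_le_of_le_one hq0.le hq1.le k.succ_ne_zero
  have : 0 < 1 - q := sub_pos.mpr hq1
  gcongr

theorem stmt17 (q : ℝ) (hq0 : 0 < q) (hq1 : q < 1) (z : ℂ) (hz : 0 < z.re) :
    fq q z / z = (1 - q) + ∫ t in Set.Ioi (0:ℝ), Complex.exp (-(t : ℂ) * z) * (hq q t : ℂ) := by
  have hz0 : z ≠ 0 := fun h => by simp [h] at hz
  have hL : 0 ≤ Real.log (1 / q) := Real.log_nonneg (one_le_one_div hq0 hq1.le)
  have hpow (k : ℕ) : Complex.exp (-(((k + 1 : ℝ) * Real.log (1 / q) : ℝ) : ℂ) * z) =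
      (q : ℂ) ^ (((k : ℂ) + 1) * z) := by
    rw [Complex.cpow_def_of_ne_zero (by exact_mod_cast hq0.ne'), ← Complex.ofReal_log hq0.le]
    congr 1
    rw [one_div, Real.log_inv]
    push_cast
    ring
  have key := (hasSum_setIntegral_Ioi_exp_mul_tsum_ite hz
    (a := fun k => ((k : ℝ) + 1) * Real.log (1 / q)) (fun k => by positivity)
    (fun k => div_nonneg (by positivity)
      (sub_nonneg.mpr (pow_le_one₀ hq0.le hq1.le)))
    (summable_pow_succ_div_one_sub_pow_succ hq0 hq1)).tsum_eq
  simp only [hpow, tsum_div_const] at key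
  simp only [hq, Complex.ofReal_mul, mul_left_comm (Complex.exp _)]
  rw [integral_const_mul, ← key, fq]
  have hterm (k : ℕ) : (q : ℂ) ^ (k + 1) * (1 - (q : ℂ) ^ (((k : ℂ) + 1) * z)) /
      (1 - (q : ℂ) ^ (k + 1)) =
      ((q ^ (k + 1) / (1 - q ^ (k + 1)) : ℝ) : ℂ) * (1 - (q : ℂ) ^ (((k : ℂ) + 1) * z)) := by
    push_cast
    ring
  simp only [hterm]
  push_cast
  field_simp
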